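/- For every integer n ≥ 2, the number of partitions of n with crank at most 0 and an even number of parts equals the number of partitions of n with mex ≡ 1 (mod 4), and the number of partitions of n with crank at most 0 and an odd number of parts equals the number of partitions of n with mex ≡ 3 (mod 4). -/

import Mathlib

/-- Number of parts equal to 1 in a partition. -/
def partOmega {n : ℕ} (P : Nat.Partition n) : ℕ := P.parts.count 1

/-- Number of parts strictly greater than `partOmega P`. -/
def partMu {n : ℕ} (P : Nat.Partition n) : ℕ :=
  (P.parts.filter (fun x => partOmega P < x)).card

/-- The crank of a partition: the largest part if there are no parts equal to 1,
and `μ(λ) - ω(λ)` otherwise. -/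
def crank {n : ℕ} (P : Nat.Partition n) : ℤ :=
  if partOmega P = 0 then (P.parts.sup : ℤ)
  else (partMu P : ℤ) - (partOmega P : ℤ)

/-- The mex of a partition: the smallest positive integer that is not a part. -/
noncomputable def partMex {n : ℕ} (P : Nat.Partition n) : ℕ :=
  sInf {k : ℕ | 0 < k ∧ k ∉ P.parts}

section QSeries
open Finset

variable {R : Type*} [CommRing R]

/-- Multiplying by `1 - z q` collapses the double series to its diagonal. -/
theorem one_sub_mul_sum_sum_eq_diagonal (q z : R) (L : ℕ) (hq : q ^ L = 0) (A B : ℕ → R)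
    (hA : ∀ m, (1 - q ^ (m + 1)) * A (m + 1) = A m)
    (hB : ∀ m, (1 - z * q ^ (m + 1)) * B (m + 1) = B m) :
    (1 - z * q) * ∑ w ∈ range L, ∑ m ∈ range (w + 1),
        z ^ (w + m) * q ^ (w + m * (w + 1)) * (A m * B w) =
      ∑ w ∈ range L, z ^ (2 * w) * q ^ (w * w + w) * (A w * B w) := by
  let h : ℕ → ℕ → R := fun m w => z ^ (m + w) * q ^ (w * (m + 1)) * (A m * B w)
  let Ψ : ℕ → R := fun w => ∑ m ∈ range (w + 1), (1 - q ^ m) * h m w - ∑ m ∈ range w, h m w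
  have key : ∀ m w, (1 - z * q) * (z ^ (w + m) * q ^ (w + m * (w + 1)) * (A m * B w)) =
      q ^ m * h m w - h m (w + 1) + (1 - q ^ (m + 1)) * h (m + 1) (w + 1) := by
    intro m w
    simp only [h]
    rw [← hA m, ← hB w]
    ring
  have step : ∀ w, (1 - z * q) * ∑ m ∈ range (w + 1),
        z ^ (w + m) * q ^ (w + m * (w + 1)) * (A m * B w) = h w w + (Ψ (w + 1) - Ψ w) := by
    intro w
    rw [mul_sum, sum_congr rfl fun m _ => key m w, sum_add_distrib, sum_sub_distrib]
    simp only [Ψ]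
    rw [sum_range_succ' (fun m => (1 - q ^ m) * h m (w + 1)) (w + 1)]
    simp only [sub_mul, one_mul, sum_sub_distrib]
    rw [sum_range_succ (fun m => h m w) w]
    simp
    ring
  have hΨ : Ψ L = 0 := by
    have h0 : ∀ m, h m L = 0 := by
      intro m
      simp only [h]
      rw [pow_mul, hq]
      simp
    simp [Ψ, h0]
  have hΨ0 : Ψ 0 = 0 := by simp [Ψ]
  rw [mul_sum, sum_congr rfl fun w _ => step w, sum_add_distrib, sum_range_sub, hΨ, hΨ0]
  simp only [sub_zero, add_zero, h]
  refine sum_congr rfl fun w _ => ?_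
  ring

theorem eq_of_le_of_pow_eq_zero {q : R} {L : ℕ} (hq : q ^ L = 0) {A : ℕ → R}
    (hA : ∀ m, (1 - q ^ (m + 1)) * A (m + 1) = A m) {j : ℕ} (hj : L ≤ j + 1) :
    A (j + 1) = A j := by
  have := hA j
  rwa [pow_eq_zero_of_le hj hq, sub_zero, one_mul] at this

/-- Durfee rectangles. -/
theorem sum_durfee_rectangle (q : R) (L : ℕ) (hq : q ^ L = 0) (A : ℕ → R)
    (hA0 : A 0 = 1) (hA : ∀ m, (1 - q ^ (m + 1)) * A (m + 1) = A m) (hL : 0 < L) (j : ℕ) :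
    ∑ m ∈ range L, q ^ (m * (m + j)) * (A m * A (m + j)) = A L := by
  let Q : ℕ → R := fun j => ∑ m ∈ range L, q ^ (m * (m + j)) * (A m * A (m + j))
  have hstep : ∀ j, Q (j + 1) = Q j := by
    intro j
    let r : ℕ → R := fun m => q ^ (m * (m + j)) * (1 - q ^ m) * (A m * A (m + j))
    have h1 : Q (j + 1) - Q j = ∑ m ∈ range L, (r (m + 1) - r m) := by
      simp only [Q, ← sum_sub_distrib]
      refine sum_congr rfl fun m _ => ?_
      have e1 := hA m
      have e2 := hA (m + j)
      simp only [r]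
      rw [show m + 1 + j = m + j + 1 by ring, show m + (j + 1) = m + j + 1 by ring, ← e2, ← e1]
      ring
    rw [sum_range_sub] at h1
    have h2 : r L = 0 := by simp only [r]; rw [pow_mul, hq, zero_pow (by lia)]; simp
    have h3 : r 0 = 0 := by simp [r]
    rw [h2, h3, sub_zero] at h1
    exact sub_eq_zero.mp h1
  have hconst : ∀ i, Q (j + i) = Q j := by
    intro i
    induction i with
    | zero => rfl
    | succ i ih => rw [← add_assoc, hstep, ih]
  have hA' : ∀ i, A (L + i) = A L := by
    intro i
    induction i with
    | zero => rfl
    | succ i ih => rw [← add_assoc, eq_of_le_of_pow_eq_zero hq hA (by lia), ih]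
  change Q j = A L
  rw [← hconst L]
  simp only [Q]
  rw [sum_eq_single_of_mem 0 (by simpa using hL)]
  · simp [hA0, add_comm j L, hA' j]
  · intro m _ hm
    rw [pow_mul', pow_eq_zero_of_le (by lia) hq, zero_pow hm, zero_mul]

theorem sum_durfee_eq_partial_theta (q : R) (L : ℕ) (hq : q ^ L = 0) (A : ℕ → R)
    (hA0 : A 0 = 1) (hA : ∀ m, (1 - q ^ (m + 1)) * A (m + 1) = A m) :
    ∑ w ∈ range L, q ^ (w * w + w) * (A w * A w) =
      A L * ∑ k ∈ range L, (-1) ^ k * q ^ (∑ i ∈ range k, (i + 1)) := by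
  rcases Nat.eq_zero_or_pos L with rfl | hL
  · simp
  let H : ℕ → R := fun j => ∑ m ∈ range L, q ^ (m * (m + (j + 1))) * (A m * A (m + j))
  have hrec : ∀ j, H j = A L - q ^ (j + 1) * H (j + 1) := by
    intro j
    rw [← sum_durfee_rectangle q L hq A hA0 hA hL (j + 1)]
    simp only [H, mul_sum, ← sum_sub_distrib]
    refine sum_congr rfl fun m _ => ?_
    rw [show m + (j + 1) = m + j + 1 by ring, ← hA (m + j)]
    ring
  have hiter : ∀ k, H 0 = A L * ∑ i ∈ range k, (-1) ^ i * q ^ (∑ i ∈ range i, (i + 1)) +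
      (-1) ^ k * q ^ (∑ i ∈ range k, (i + 1)) * H k := by
    intro k
    induction k with
    | zero => simp
    | succ k ih =>
      rw [ih, hrec k, sum_range_succ, sum_range_succ (fun i => i + 1), pow_add]
      ring
  have hT : L ≤ ∑ i ∈ range L, (i + 1) := by
    calc L = ∑ i ∈ range L, 1 := by simp
      _ ≤ _ := sum_le_sum fun i _ => by lia
  have := hiter L
  rw [pow_eq_zero_of_le hT hq] at this
  simp only [mul_zero, zero_mul, add_zero] at this
  rw [← this]
  simp only [H]
  refine sum_congr rfl fun m _ => ?_
  rw [zero_add, add_zero, mul_add, mul_one]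

/-- Shanks' finite form of Gauss's triangular number identity. -/
theorem shanks_identity (x : R) (ρ : ℕ → R)
    (hu : ∀ m, IsUnit (1 - x ^ (2 * m + 2)))
    (hρ : ∀ m, (1 - x ^ (2 * m + 2)) * ρ (m + 1) = (1 - x ^ (2 * m + 1)) * ρ m) (n : ℕ) :
    ρ n * ∑ k ∈ range (2 * n), x ^ (∑ i ∈ range k, (i + 1)) =
      ∑ s ∈ range n, ρ s * x ^ (s * (2 * n + 1)) := by
  induction n with
  | zero => simp
  | succ n ih =>
    have hT : ∑ i ∈ range (2 * n), (i + 1) = n * (2 * n + 1) := by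
      clear ih
      induction n with
      | zero => simp
      | succ n ih => rw [mul_add, sum_range_succ, sum_range_succ, ih]; ring
    apply (hu n).mul_left_cancel
    let τ : ℕ → R := fun s => ρ s * x ^ (s * (2 * n + 1)) * (1 - x ^ (2 * s))
    have tel : (1 - x ^ (2 * n + 1)) * ∑ s ∈ range n, ρ s * x ^ (s * (2 * n + 1)) -
        (1 - x ^ (2 * n + 2)) * ∑ s ∈ range n, ρ s * x ^ (s * (2 * (n + 1) + 1)) = - τ n := by
      rw [mul_sum, mul_sum, ← sum_sub_distrib]
      have : - τ n = ∑ s ∈ range n, (τ s - τ (s + 1)) := by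
        rw [sum_range_sub']
        simp [τ]
      rw [this]
      refine sum_congr rfl fun s _ => ?_
      simp only [τ]
      linear_combination x ^ ((s + 1) * (2 * n + 1)) * hρ s
    rw [← mul_assoc, hρ n, mul_add, sum_range_succ, sum_range_succ, sum_range_succ _ (2 * n), hT,
      sum_range_succ _ n]
    simp only [τ] at tel
    linear_combination (1 - x ^ (2 * n + 1)) * ih + tel

theorem sum_even_durfee_eq_prod (q : R) (L : ℕ) (hq : q ^ L = 0) (D : ℕ → R)
    (hD0 : D 0 = 1) (hD : ∀ m, (1 - q ^ (2 * m + 2)) * D (m + 1) = D m) (hL : 0 < L) :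
    ∑ m ∈ range L, q ^ (m * m + m) * D m = ∏ k ∈ range L, (1 + q ^ (2 * k + 2)) := by
  let N : ℕ → R := fun i => ∑ m ∈ range L, q ^ (m * m + m + 2 * i * m) * D m
  have hrec : ∀ i, N i = (1 + q ^ (2 * i + 2)) * N (i + 1) := by
    intro i
    let r : ℕ → R := fun m => q ^ (m * m + m + 2 * i * m) * (1 - q ^ (2 * m)) * D m
    have h1 : (1 + q ^ (2 * i + 2)) * N (i + 1) - N i = ∑ m ∈ range L, (r (m + 1) - r m) := by
      simp only [N, mul_sum, ← sum_sub_distrib]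
      refine sum_congr rfl fun m _ => ?_
      simp only [r]
      rw [← hD m]
      ring
    rw [sum_range_sub] at h1
    have h2 : r L = 0 := by
      simp only [r]
      rw [pow_eq_zero_of_le (by nlinarith) hq]; simp
    have h3 : r 0 = 0 := by simp [r]
    rw [h2, h3, sub_zero] at h1
    exact (sub_eq_zero.mp h1).symm
  have hiter : ∀ k, N 0 = (∏ i ∈ range k, (1 + q ^ (2 * i + 2))) * N k := by
    intro k
    induction k with
    | zero => simp
    | succ k ih => rw [ih, hrec k, prod_range_succ]; ring
  have hNL : N L = 1 := by
    simp only [N]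
    rw [sum_eq_single_of_mem 0 (by simpa using hL)]
    · simp [hD0]
    · intro m _ hm
      have : 1 ≤ m := Nat.pos_of_ne_zero hm
      rw [pow_eq_zero_of_le (by nlinarith) hq, zero_mul]
  have := hiter L
  rw [hNL, mul_one] at this
  rw [← this]
  simp [N]

theorem sum_signed_durfee_eq_theta (q : R) (L : ℕ) (hq : q ^ L = 0) (A B : ℕ → R)
    (hA0 : A 0 = 1) (hB0 : B 0 = 1) (hA : ∀ m, (1 - q ^ (m + 1)) * A (m + 1) = A m)
    (hB : ∀ m, (1 + q ^ (m + 1)) * B (m + 1) = B m) :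
    ∑ w ∈ range L, q ^ (w * w + w) * (A w * B w) =
      A L * ∑ k ∈ range L, (-q) ^ (∑ i ∈ range k, (i + 1)) := by
  rcases Nat.eq_zero_or_pos L with rfl | hL
  · simp
  let D : ℕ → R := fun m => A m * B m
  let γ : ℕ → R := fun m => ∏ k ∈ range m, (1 + q ^ (2 * k + 1))
  have hD : ∀ m, (1 - q ^ (2 * m + 2)) * D (m + 1) = D m := by
    intro m
    simp only [D]
    rw [← hA m, ← hB m]
    ring
  have hx : (-q) ^ L = 0 := by rw [neg_pow, hq, mul_zero]
  have hu : ∀ m, IsUnit (1 - (-q) ^ (2 * m + 2)) := fun m =>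
    IsNilpotent.isUnit_one_sub ⟨L, by rw [← pow_mul, mul_comm, pow_mul, hx, zero_pow (by lia)]⟩
  have hsh := shanks_identity (-q) (fun m => γ m * D m) hu (by
    intro m
    have e1 : (-q) ^ (2 * m + 2) = q ^ (2 * m + 2) := Even.neg_pow (by simp [parity_simps]) q
    have e2 : (-q) ^ (2 * m + 1) = - q ^ (2 * m + 1) := Odd.neg_pow (by simp) q
    rw [e1, e2, ← hD m]
    simp only [γ, prod_range_succ]
    ring) L
  have hone : ∑ s ∈ range L, γ s * D s * (-q) ^ (s * (2 * L + 1)) = 1 := by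
    rw [sum_eq_single_of_mem 0 (by simpa using hL)]
    · simp [γ, D, hA0, hB0]
    · intro s _ hs
      have : 1 ≤ s := Nat.pos_of_ne_zero hs
      rw [pow_eq_zero_of_le (by nlinarith) hx, mul_zero]
  rw [hone] at hsh
  have hT : ∀ k, k ≤ ∑ i ∈ range k, (i + 1) := by
    intro k
    calc k = ∑ i ∈ range k, 1 := by simp
      _ ≤ _ := sum_le_sum fun i _ => by lia
  have hψ : ∑ k ∈ range (2 * L), (-q) ^ (∑ i ∈ range k, (i + 1)) =
      ∑ k ∈ range L, (-q) ^ (∑ i ∈ range k, (i + 1)) := by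
    symm
    apply sum_subset (by intro k; simp; lia)
    intro k _ hk
    refine pow_eq_zero_of_le (le_trans ?_ (hT k)) hx
    simpa using hk
  rw [hψ] at hsh
  have hprod : ∀ m, γ m * ∏ k ∈ range m, (1 + q ^ (2 * k + 2)) =
      ∏ k ∈ range (2 * m), (1 + q ^ (k + 1)) := by
    intro m
    induction m with
    | zero => simp [γ]
    | succ m ih =>
      rw [mul_add, mul_one, prod_range_succ (fun k => 1 + q ^ (k + 1)) (2 * m + 1),
        prod_range_succ (fun k => 1 + q ^ (k + 1)) (2 * m), ← ih]
      simp only [γ, prod_range_succ]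
      ring
  have hBprod : ∀ m, (∏ k ∈ range m, (1 + q ^ (k + 1))) * B m = 1 := by
    intro m
    induction m with
    | zero => simp [hB0]
    | succ m ih => rw [prod_range_succ, mul_assoc, hB, ih]
  have hB' : ∀ i, B (L + i) = B L := by
    intro i
    induction i with
    | zero => rfl
    | succ i ih =>
      have := hB (L + i)
      rw [pow_eq_zero_of_le (by lia) hq, add_zero, one_mul, ih] at this
      exact this
  have hN := sum_even_durfee_eq_prod q L hq D (by simp [D, hA0, hB0]) hD hL
  have h1 := hBprod (2 * L)
  rw [two_mul, hB', ← two_mul, ← hprod L] at h1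
  simp only [D] at hN hsh
  rw [hN]
  linear_combination (-(∏ k ∈ range L, (1 + q ^ (2 * k + 2)))) * hsh +
    (A L * ∑ k ∈ range L, (-q) ^ (∑ i ∈ range k, (i + 1))) * h1

end QSeries

section PartitionSeries
open Finset PowerSeries
open scoped Classical

/-- The multisets of positive integers with sum `n`. -/
noncomputable def multisetsOfSum (n : ℕ) : Finset (Multiset ℕ) :=
  (univ : Finset (Nat.Partition n)).image Nat.Partition.parts

theorem mem_multisetsOfSum {n : ℕ} {s : Multiset ℕ} :
    s ∈ multisetsOfSum n ↔ (∀ i ∈ s, 0 < i) ∧ s.sum = n := by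
  simp only [multisetsOfSum, mem_image, mem_univ, true_and]
  constructor
  · rintro ⟨P, rfl⟩
    exact ⟨fun i hi => P.parts_pos hi, P.parts_sum⟩
  · rintro ⟨h1, h2⟩
    exact ⟨⟨s, fun hi => h1 _ hi, h2⟩, rfl⟩

/-- The generating function of the partitions satisfying `S`, where each part has weight `z`. -/
noncomputable def partSeries (z : ℤ) (S : Multiset ℕ → Prop) : ℤ⟦X⟧ :=
  PowerSeries.mk fun n => ∑ s ∈ (multisetsOfSum n).filter S, z ^ Multiset.card s

theorem coeff_partSeries (z : ℤ) (S : Multiset ℕ → Prop) (n : ℕ) :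
    coeff n (partSeries z S) = ∑ P : Nat.Partition n,
      if S P.parts then z ^ Multiset.card P.parts else 0 := by
  rw [partSeries, coeff_mk, sum_filter, multisetsOfSum, sum_image]
  intro P _ Q _ h
  exact Nat.Partition.ext h

theorem partSeries_congr (z : ℤ) {S T : Multiset ℕ → Prop}
    (h : ∀ s : Multiset ℕ, (∀ i ∈ s, 0 < i) → (S s ↔ T s)) : partSeries z S = partSeries z T := by
  ext n
  rw [coeff_partSeries, coeff_partSeries]
  refine sum_congr rfl fun P _ => ?_
  simp only [h P.parts fun i hi => P.parts_pos hi]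

theorem partSeries_eq_add (z : ℤ) (S T : Multiset ℕ → Prop) :
    partSeries z S =
      partSeries z (fun s => T s ∧ S s) + partSeries z (fun s => ¬ T s ∧ S s) := by
  ext n
  rw [map_add, coeff_partSeries, coeff_partSeries, coeff_partSeries, ← sum_add_distrib]
  refine sum_congr rfl fun P _ => ?_
  by_cases hT : T P.parts <;> simp [hT]

theorem partSeries_eq_smul_of_bij (z : ℤ) (S T : Multiset ℕ → Prop) (d : ℕ) (c : ℤ)
    (f g : Multiset ℕ → Multiset ℕ)
    (hf : ∀ s : Multiset ℕ, (∀ i ∈ s, 0 < i) → S s → T (f s) ∧ (∀ i ∈ f s, 0 < i) ∧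
      (f s).sum = s.sum + d ∧ z ^ Multiset.card (f s) = c * z ^ Multiset.card s ∧ g (f s) = s)
    (hg : ∀ s : Multiset ℕ, (∀ i ∈ s, 0 < i) → T s → S (g s) ∧ (∀ i ∈ g s, 0 < i) ∧
      f (g s) = s) :
    partSeries z T = C c * X ^ d * partSeries z S := by
  ext n
  rw [mul_assoc, coeff_C_mul, coeff_X_pow_mul', partSeries, partSeries, coeff_mk, coeff_mk]
  have hgs : ∀ s : Multiset ℕ, (∀ i ∈ s, 0 < i) → T s → (g s).sum + d = s.sum := by
    intro s h1 h2
    obtain ⟨h3, h4, h5⟩ := hg s h1 h2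
    rw [← (hf _ h4 h3).2.2.1, h5]
  split_ifs with hd
  · rw [mul_sum]
    symm
    refine sum_bij' (fun s _ => f s) (fun s _ => g s) ?_ ?_ ?_ ?_ ?_
    · intro s hs
      simp only [mem_filter, mem_multisetsOfSum] at hs ⊢
      obtain ⟨h1, h2, h3, -⟩ := hf s hs.1.1 hs.2
      exact ⟨⟨h2, by lia⟩, h1⟩
    · intro s hs
      simp only [mem_filter, mem_multisetsOfSum] at hs ⊢
      obtain ⟨h1, h2, h3⟩ := hg s hs.1.1 hs.2
      have := hgs s hs.1.1 hs.2
      exact ⟨⟨h2, by lia⟩, h1⟩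
    · intro s hs
      simp only [mem_filter, mem_multisetsOfSum] at hs
      exact (hf s hs.1.1 hs.2).2.2.2.2
    · intro s hs
      simp only [mem_filter, mem_multisetsOfSum] at hs
      exact (hg s hs.1.1 hs.2).2.2
    · intro s hs
      simp only [mem_filter, mem_multisetsOfSum] at hs
      exact (hf s hs.1.1 hs.2).2.2.2.1.symm
  · rw [mul_zero]
    apply sum_eq_zero
    intro s hs
    simp only [mem_filter, mem_multisetsOfSum] at hs
    have := hgs s hs.1.1 hs.2
    lia

theorem partSeries_insert (z : ℤ) (S : Multiset ℕ → Prop) {a : ℕ} (ha : 0 < a) :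
    partSeries z (fun s => a ∈ s ∧ S (s.erase a)) = C z * X ^ a * partSeries z S := by
  refine partSeries_eq_smul_of_bij z _ _ a z (fun s => a ::ₘ s) (fun s => s.erase a) ?_ ?_
  · intro s hs h
    refine ⟨by simpa using h, ?_, by simp [add_comm], by simp [pow_succ'], by simp⟩
    intro i hi
    rcases Multiset.mem_cons.mp hi with rfl | hi
    exacts [ha, hs i hi]
  · intro s hs h
    exact ⟨h.2, fun i hi => hs i (Multiset.mem_of_mem_erase hi), Multiset.cons_erase h.1⟩

theorem partSeries_shift (z : ℤ) (w m : ℕ) :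
    partSeries z (fun s => (∀ i ∈ s, w + 1 < i) ∧ Multiset.card s = m) =
      X ^ m * partSeries z (fun s => (∀ i ∈ s, w < i) ∧ Multiset.card s = m) := by
  have := partSeries_eq_smul_of_bij z (fun s => (∀ i ∈ s, w < i) ∧ Multiset.card s = m)
    (fun s => (∀ i ∈ s, w + 1 < i) ∧ Multiset.card s = m) m 1
    (Multiset.map (· + 1)) (Multiset.map (· - 1)) ?_ ?_
  · simpa using this
  · rintro s hs ⟨h, rfl⟩
    refine ⟨⟨?_, by simp⟩, by simp, ?_, by simp, by simp⟩
    · simpa using h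
    · simp [Multiset.sum_map_add]
  · rintro s hs ⟨h, rfl⟩
    refine ⟨⟨?_, by simp⟩, ?_, ?_⟩
    · simp only [Multiset.mem_map, forall_exists_index, and_imp, forall_apply_eq_imp_iff₂]
      intro a ha
      have := h a ha
      lia
    · simp only [Multiset.mem_map, forall_exists_index, and_imp, forall_apply_eq_imp_iff₂]
      intro a ha
      have := h a ha
      lia
    · rw [Multiset.map_map]
      conv_rhs => rw [← Multiset.map_id s]
      refine Multiset.map_congr rfl fun a ha => ?_
      have := hs a ha
      simp
      lia

theorem partSeries_filter_mul (z : ℤ) (p : ℕ → Prop) [DecidablePred p] (S T : Multiset ℕ → Prop) :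
    partSeries z (fun s => S (s.filter p) ∧ T (s.filter fun i => ¬ p i)) =
      partSeries z (fun s => (∀ i ∈ s, p i) ∧ S s) *
        partSeries z (fun s => (∀ i ∈ s, ¬ p i) ∧ T s) := by
  ext n
  rw [coeff_mul]
  simp only [partSeries, coeff_mk, sum_mul_sum, ← sum_product']
  rw [sum_sigma']
  refine sum_bij' (fun s _ => ⟨((s.filter p).sum, (s.filter fun i => ¬ p i).sum),
    (s.filter p, s.filter fun i => ¬ p i)⟩) (fun x _ => x.2.1 + x.2.2) ?_ ?_ ?_ ?_ ?_
  · intro s hs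
    simp only [mem_filter, mem_multisetsOfSum] at hs
    simp only [mem_sigma, HasAntidiagonal.mem_antidiagonal, mem_product, mem_filter, mem_multisetsOfSum,
      Multiset.mem_filter]
    refine ⟨?_, ⟨⟨fun i hi => hs.1.1 i hi.1, trivial⟩, fun i hi => hi.2, hs.2.1⟩,
      ⟨⟨fun i hi => hs.1.1 i hi.1, trivial⟩, fun i hi => hi.2, hs.2.2⟩⟩
    rw [← Multiset.sum_add, Multiset.filter_add_not]
    exact hs.1.2
  · rintro ⟨⟨a, b⟩, ⟨s, t⟩⟩ hx
    simp only [mem_sigma, HasAntidiagonal.mem_antidiagonal, mem_product, mem_filter, mem_multisetsOfSum] at hx ⊢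
    obtain ⟨hab, ⟨⟨hs0, hs1⟩, hs2, hs3⟩, ⟨ht0, ht1⟩, ht2, ht3⟩ := hx
    refine ⟨⟨?_, by rw [Multiset.sum_add, hs1, ht1, hab]⟩, ?_⟩
    · intro i hi
      rcases Multiset.mem_add.mp hi with hi | hi
      exacts [hs0 i hi, ht0 i hi]
    · rw [Multiset.filter_add, Multiset.filter_add, Multiset.filter_eq_self.mpr hs2,
        Multiset.filter_eq_nil.mpr ht2, Multiset.filter_eq_self.mpr ht2,
        Multiset.filter_eq_nil.mpr (fun i hi => not_not.mpr (hs2 i hi))]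
      simpa using ⟨hs3, ht3⟩
  · intro s hs
    exact Multiset.filter_add_not p s
  · rintro ⟨⟨a, b⟩, ⟨s, t⟩⟩ hx
    simp only [mem_sigma, HasAntidiagonal.mem_antidiagonal, mem_product, mem_filter, mem_multisetsOfSum] at hx ⊢
    obtain ⟨hab, ⟨⟨hs0, hs1⟩, hs2, hs3⟩, ⟨ht0, ht1⟩, ht2, ht3⟩ := hx
    have e1 : (s + t).filter p = s := by
      rw [Multiset.filter_add, Multiset.filter_eq_self.mpr hs2, Multiset.filter_eq_nil.mpr ht2,
        add_zero]
    have e2 : ((s + t).filter fun i => ¬ p i) = t := by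
      rw [Multiset.filter_add, Multiset.filter_eq_self.mpr ht2,
        Multiset.filter_eq_nil.mpr (fun i hi => not_not.mpr (hs2 i hi)), zero_add]
    simp only [e1, e2, hs1, ht1]
  · intro s hs
    simp only [← pow_add, ← Multiset.card_add, Multiset.filter_add_not]

/-- Partitions with all parts at most `w`. -/
noncomputable def boundedSeries (z : ℤ) (w : ℕ) : ℤ⟦X⟧ := partSeries z fun s => ∀ i ∈ s, i ≤ w

theorem partSeries_nil (z : ℤ) (S : Multiset ℕ → Prop)
    (h : ∀ s : Multiset ℕ, (∀ i ∈ s, 0 < i) → (S s ↔ s = 0)) : partSeries z S = 1 := by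
  rw [partSeries_congr z h]
  ext n
  rw [partSeries, coeff_mk, coeff_one]
  split_ifs with hn
  · rw [sum_eq_single_of_mem 0]
    · simp
    · simp [mem_multisetsOfSum, hn]
    · intro s hs
      simp only [mem_filter] at hs
      exact fun h => absurd hs.2 h
  · refine sum_eq_zero fun s hs => ?_
    simp only [mem_filter, mem_multisetsOfSum] at hs
    obtain ⟨⟨-, h⟩, rfl⟩ := hs
    exact absurd h.symm (by simpa using hn)

theorem boundedSeries_zero (z : ℤ) : boundedSeries z 0 = 1 := by
  refine partSeries_nil z _ fun s hs => ⟨fun h => ?_, by rintro rfl; simp⟩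
  refine Multiset.eq_zero_of_forall_notMem fun i hi => ?_
  have := hs i hi
  have := h i hi
  lia

theorem one_sub_mul_boundedSeries (z : ℤ) (w : ℕ) :
    (1 - C z * X ^ (w + 1)) * boundedSeries z (w + 1) = boundedSeries z w := by
  have h := partSeries_eq_add z (fun s => ∀ i ∈ s, i ≤ w + 1) (fun s => w + 1 ∈ s)
  have h1 := partSeries_insert z (fun s => ∀ i ∈ s, i ≤ w + 1) (show 0 < w + 1 by lia)
  have h2 : partSeries z (fun s => w + 1 ∈ s ∧ ∀ i ∈ s, i ≤ w + 1) =
      partSeries z (fun s => w + 1 ∈ s ∧ ∀ i ∈ s.erase (w + 1), i ≤ w + 1) := by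
    refine partSeries_congr z fun s _ => and_congr_right fun hw => ?_
    conv_lhs => rw [← Multiset.cons_erase hw]
    simp
  have h3 : partSeries z (fun s => w + 1 ∉ s ∧ ∀ i ∈ s, i ≤ w + 1) =
      partSeries z (fun s => ∀ i ∈ s, i ≤ w) := by
    refine partSeries_congr z fun s _ => ⟨fun ⟨h1, h2⟩ i hi => ?_, fun h => ⟨fun hw => ?_, ?_⟩⟩
    · have := h2 i hi
      have : i ≠ w + 1 := by rintro rfl; exact h1 hi
      lia
    · have := h _ hw
      lia
    · intro i hi
      have := h i hi
      lia
  rw [h2, h1, h3] at h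
  simp only [boundedSeries]
  linear_combination h

theorem partSeries_bounded_count_one (z : ℤ) (w c : ℕ) :
    partSeries z (fun s => (∀ i ∈ s, i ≤ w + 1) ∧ s.count 1 = c) =
      C (z ^ c) * X ^ c * ((1 - C z * X) * boundedSeries z (w + 1)) := by
  have key : ∀ (S : Multiset ℕ → Prop) (d : ℕ),
      (∀ s, S s ↔ (1 ∈ s ∧ ((∀ i ∈ s.erase 1, i ≤ w + 1) ∧ (s.erase 1).count 1 = d))) →
      partSeries z S = C z * X *
        partSeries z (fun s => (∀ i ∈ s, i ≤ w + 1) ∧ s.count 1 = d) := by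
    intro S d h
    rw [partSeries_congr z fun s _ => h s, partSeries_insert z (fun s =>
      (∀ i ∈ s, i ≤ w + 1) ∧ s.count 1 = d) one_pos, pow_one]
  induction c with
  | zero =>
    have h := partSeries_eq_add z (fun s => ∀ i ∈ s, i ≤ w + 1) (fun s => 1 ∈ s)
    have h1 := partSeries_insert z (fun s => ∀ i ∈ s, i ≤ w + 1) one_pos
    have h2 : partSeries z (fun s => 1 ∈ s ∧ ∀ i ∈ s, i ≤ w + 1) =
        partSeries z (fun s => 1 ∈ s ∧ ∀ i ∈ s.erase 1, i ≤ w + 1) := by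
      refine partSeries_congr z fun s _ => and_congr_right fun hw => ?_
      conv_lhs => rw [← Multiset.cons_erase hw]
      simp
    have h3 : partSeries z (fun s => (∀ i ∈ s, i ≤ w + 1) ∧ s.count 1 = 0) =
        partSeries z (fun s => 1 ∉ s ∧ ∀ i ∈ s, i ≤ w + 1) :=
      partSeries_congr z fun s _ => by rw [Multiset.count_eq_zero, and_comm]
    rw [h2, h1] at h
    rw [h3]
    simp only [boundedSeries, pow_zero, map_one]
    linear_combination -h
  | succ c ih =>
    rw [key _ c, ih]
    · simp only [pow_succ, map_mul]
      ring
    · intro s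
      constructor
      · rintro ⟨h1, h2⟩
        have hm : 1 ∈ s := Multiset.count_pos.mp (by lia)
        exact ⟨hm, fun i hi => h1 i (Multiset.mem_of_mem_erase hi), by simp [h2]⟩
      · rintro ⟨hm, h1, h2⟩
        refine ⟨fun i hi => ?_, ?_⟩
        · rw [← Multiset.cons_erase hm] at hi
          rcases Multiset.mem_cons.mp hi with rfl | hi
          exacts [by lia, h1 i hi]
        · rw [← Multiset.cons_erase hm, Multiset.count_cons_self, h2]

theorem partSeries_card_eq (z : ℤ) (w m : ℕ) :
    partSeries z (fun s => (∀ i ∈ s, w < i) ∧ Multiset.card s = m) =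
      C (z ^ m) * X ^ (m * (w + 1)) * boundedSeries 1 m := by
  induction m with
  | zero =>
    rw [boundedSeries_zero]
    simp only [pow_zero, map_one, zero_mul, mul_one]
    refine partSeries_nil z _ fun s hs => ⟨fun h => by simpa using h.2, by rintro rfl; simp⟩
  | succ m ih =>
    have h := partSeries_eq_add z (fun s => (∀ i ∈ s, w < i) ∧ Multiset.card s = m + 1)
      (fun s => w + 1 ∈ s)
    have h1 := partSeries_insert z (fun s => (∀ i ∈ s, w < i) ∧ Multiset.card s = m)
      (show 0 < w + 1 by lia)
    have h2 : partSeries z (fun s => w + 1 ∈ s ∧ (∀ i ∈ s, w < i) ∧ Multiset.card s = m + 1) =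
        partSeries z (fun s => w + 1 ∈ s ∧ (∀ i ∈ s.erase (w + 1), w < i) ∧
          Multiset.card (s.erase (w + 1)) = m) := by
      refine partSeries_congr z fun s _ => and_congr_right fun hw => ?_
      conv_lhs => rw [← Multiset.cons_erase hw]
      simp
    have h3 : partSeries z (fun s => w + 1 ∉ s ∧ (∀ i ∈ s, w < i) ∧ Multiset.card s = m + 1) =
        partSeries z (fun s => (∀ i ∈ s, w + 1 < i) ∧ Multiset.card s = m + 1) := by
      refine partSeries_congr z fun s _ => ?_
      rw [← and_assoc]
      refine and_congr_left fun _ => ⟨fun ⟨h1, h2⟩ i hi => ?_, fun h => ⟨fun hw => ?_, ?_⟩⟩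
      · have := h2 i hi
        have : i ≠ w + 1 := by rintro rfl; exact h1 hi
        lia
      · have := h _ hw
        lia
      · intro i hi
        have := h i hi
        lia
    rw [h2, h1, h3, partSeries_shift, ih] at h
    have hb := one_sub_mul_boundedSeries 1 m
    have hne : (1 - X ^ (m + 1) : ℤ⟦X⟧) ≠ 0 := by
      intro h0
      have := congrArg constantCoeff h0
      simp at this
    apply mul_left_cancel₀ hne
    rw [map_one, one_mul] at hb
    rw [← hb] at h
    simp only [pow_succ, map_mul, mul_add, add_mul, pow_add] at h ⊢
    linear_combination h

theorem partSeries_count_one_card_filter (z : ℤ) (w m : ℕ) :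
    partSeries z (fun s => s.count 1 = w + 1 ∧ Multiset.card (s.filter (w + 1 < ·)) = m) =
      (1 - C z * X) * (C z ^ (w + 1 + m) * X ^ (w + 1 + m * (w + 1 + 1)) *
        (boundedSeries 1 m * boundedSeries z (w + 1))) := by
  have h := partSeries_filter_mul z (· ≤ w + 1) (fun s => s.count 1 = w + 1)
    (fun s => Multiset.card s = m)
  have h1 : partSeries z (fun s => (∀ i ∈ s, ¬ i ≤ w + 1) ∧ Multiset.card s = m) =
      partSeries z (fun s => (∀ i ∈ s, w + 1 < i) ∧ Multiset.card s = m) :=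
    partSeries_congr z fun s _ => by simp only [not_le]
  rw [h1, partSeries_bounded_count_one, partSeries_card_eq] at h
  have h2 : partSeries z (fun s => s.count 1 = w + 1 ∧
      Multiset.card (s.filter (w + 1 < ·)) = m) = partSeries z (fun s =>
        (s.filter (· ≤ w + 1)).count 1 = w + 1 ∧
          Multiset.card (s.filter fun i => ¬ i ≤ w + 1) = m) := by
    refine partSeries_congr z fun s _ => ?_
    rw [Multiset.count_filter_of_pos (by lia)]
    simp only [not_le]
  rw [h2, h]
  simp only [map_pow, map_mul, pow_add, pow_one]
  ring

/-- Partitions containing each of `1, …, k`. -/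
theorem partSeries_contains (k : ℕ) :
    partSeries 1 (fun s => ∀ i, 1 ≤ i → i ≤ k → i ∈ s) =
      X ^ (∑ i ∈ range k, (i + 1)) * partSeries 1 (fun _ => True) := by
  induction k with
  | zero =>
    rw [sum_range_zero, pow_zero, one_mul]
    refine partSeries_congr 1 fun s _ => ⟨fun _ => trivial, fun _ i _ _ => by lia⟩
  | succ k ih =>
    have h1 := partSeries_insert 1 (fun s => ∀ i, 1 ≤ i → i ≤ k → i ∈ s) (show 0 < k + 1 by lia)
    rw [ih] at h1
    rw [sum_range_succ, pow_add]
    have h2 : partSeries 1 (fun s => ∀ i, 1 ≤ i → i ≤ k + 1 → i ∈ s) =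
        partSeries 1 (fun s => k + 1 ∈ s ∧ ∀ i, 1 ≤ i → i ≤ k → i ∈ s.erase (k + 1)) := by
      refine partSeries_congr 1 fun s _ => ⟨fun h => ⟨h _ (by lia) le_rfl, fun i hi hk => ?_⟩,
        fun h i hi hk => ?_⟩
      · rw [Multiset.mem_erase_of_ne (by lia)]
        exact h i hi (by lia)
      · rcases Nat.lt_or_ge k i with hlt | hge
        · obtain rfl : i = k + 1 := by lia
          exact h.1
        · exact Multiset.mem_of_mem_erase (h.2 i hi hge)
    rw [h2, h1, map_one]
    ring

end PartitionSeries

section CrankMex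
open Finset PowerSeries
open scoped Classical

theorem coeff_eq_of_mk_eq {L n : ℕ} (hn : n < L) {f g : ℤ⟦X⟧}
    (h : Ideal.Quotient.mk (Ideal.span {(X : ℤ⟦X⟧) ^ L}) f = Ideal.Quotient.mk _ g) :
    coeff n f = coeff n g := by
  rw [Ideal.Quotient.eq, Ideal.mem_span_singleton, X_pow_dvd_iff] at h
  have := h n hn
  rwa [map_sub, sub_eq_zero] at this

theorem mk_boundedSeries_eq (z : ℤ) (L : ℕ) :
    Ideal.Quotient.mk (Ideal.span {(X : ℤ⟦X⟧) ^ L}) (boundedSeries z L) =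
      Ideal.Quotient.mk _ (partSeries z fun _ => True) := by
  rw [Ideal.Quotient.eq, Ideal.mem_span_singleton, X_pow_dvd_iff]
  intro n hn
  rw [map_sub, sub_eq_zero, boundedSeries, coeff_partSeries, coeff_partSeries]
  refine sum_congr rfl fun P _ => ?_
  have : ∀ i ∈ P.parts, i ≤ L := fun i hi =>
    ((Multiset.le_sum_of_mem hi).trans_eq P.parts_sum).trans hn.le
  rw [if_pos this, if_pos trivial]

/-- Summation of `partSeries` over the number of ones and the number of larger parts. -/
theorem coeff_partSeries_card_filter_le_count (z : ℤ) {n L : ℕ} (hL : n < L) :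
    coeff n (partSeries z fun s => Multiset.card (s.filter (s.count 1 < ·)) ≤ s.count 1) =
      ∑ w ∈ range L, ∑ m ∈ range (w + 1), coeff n (partSeries z fun s =>
        s.count 1 = w ∧ Multiset.card (s.filter (w < ·)) = m) := by
  simp only [coeff_partSeries]
  rw [sum_congr rfl fun w _ => sum_comm, sum_comm]
  refine sum_congr rfl fun P _ => ?_
  have hw : P.parts.count 1 < L := by
    have h1 := Multiset.count_le_card 1 P.parts
    have h2 : P.parts.card ≤ P.parts.sum := by
      have := Multiset.card_nsmul_le_sum (s := P.parts) (a := 1) fun i hi => P.parts_pos hi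
      simpa using this
    rw [P.parts_sum] at h2
    lia
  rw [sum_eq_single_of_mem (P.parts.count 1) (mem_range.mpr hw)]
  · simp only [true_and]
    rw [sum_ite_eq]
    simp
  · intro w _ hne
    exact sum_eq_zero fun m _ => if_neg fun h => hne h.1.symm

theorem coeff_partSeries_eq_double_sum (z : ℤ) {n L : ℕ} (hn : 2 ≤ n) (hL : n < L) :
    coeff n (partSeries z fun s => Multiset.card (s.filter (s.count 1 < ·)) ≤ s.count 1) =
      coeff n ((1 - C z * X) * ∑ w ∈ range L, ∑ m ∈ range (w + 1),
        C z ^ (w + m) * X ^ (w + m * (w + 1)) * (boundedSeries 1 m * boundedSeries z w)) := by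
  rw [coeff_partSeries_card_filter_le_count z hL]
  simp only [mul_sum, map_sum]
  refine sum_congr rfl fun w _ => sum_congr rfl fun m hm => ?_
  cases w with
  | zero =>
    obtain rfl : m = 0 := by simpa using hm
    rw [partSeries_nil]
    · have h1 : (1 : ℕ) ≠ n := by lia
      have h0 : n ≠ 0 := by lia
      simp only [boundedSeries_zero, add_zero, pow_zero, zero_mul, mul_one, map_sub, coeff_C_mul,
        coeff_X, coeff_one]
      simp [h0, h1.symm]
    · intro s hs
      refine ⟨fun h => ?_, by rintro rfl; simp⟩
      rw [Multiset.filter_eq_self.mpr hs] at h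
      simpa using h.2
  | succ w => rw [partSeries_count_one_card_filter]

theorem map_double_sum_one_eq {R : Type*} [CommRing R] (π : ℤ⟦X⟧ →+* R) (L : ℕ)
    (hq : π X ^ L = 0) (hP : π (boundedSeries 1 L) = π (partSeries 1 fun _ => True)) :
    π ((1 - C 1 * X) * ∑ w ∈ range L, ∑ m ∈ range (w + 1),
        C 1 ^ (w + m) * X ^ (w + m * (w + 1)) * (boundedSeries 1 m * boundedSeries 1 w)) =
      π (partSeries 1 (fun _ => True) *
        ∑ k ∈ range L, (-1) ^ k * X ^ (∑ i ∈ range k, (i + 1))) := by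
  have hA0 : π (boundedSeries 1 0) = 1 := by rw [boundedSeries_zero, map_one]
  have hA : ∀ m, (1 - π X ^ (m + 1)) * π (boundedSeries 1 (m + 1)) = π (boundedSeries 1 m) := by
    intro m
    rw [← one_sub_mul_boundedSeries 1 m]
    simp only [map_mul, map_sub, map_pow, map_one, one_mul]
  have h1 := one_sub_mul_sum_sum_eq_diagonal (π X) 1 L hq (fun m => π (boundedSeries 1 m))
    (fun m => π (boundedSeries 1 m)) hA (by simpa only [one_mul] using hA)
  have h2 := sum_durfee_eq_partial_theta (π X) L hq (fun m => π (boundedSeries 1 m)) hA0 hA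
  rw [hP] at h2
  simp only [one_pow, one_mul] at h1
  rw [h2] at h1
  simp only [map_mul, map_sub, map_sum, map_pow, map_one, map_neg, one_pow, one_mul]
  exact h1

theorem map_double_sum_neg_one_eq {R : Type*} [CommRing R] (π : ℤ⟦X⟧ →+* R) (L : ℕ)
    (hq : π X ^ L = 0) (hP : π (boundedSeries 1 L) = π (partSeries 1 fun _ => True)) :
    π ((1 - C (-1) * X) * ∑ w ∈ range L, ∑ m ∈ range (w + 1),
        C (-1) ^ (w + m) * X ^ (w + m * (w + 1)) *
          (boundedSeries 1 m * boundedSeries (-1) w)) =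
      π (partSeries 1 (fun _ => True) * ∑ k ∈ range L, (-X) ^ (∑ i ∈ range k, (i + 1))) := by
  have hA0 : ∀ z, π (boundedSeries z 0) = 1 := by
    intro z
    rw [boundedSeries_zero, map_one]
  have hA : ∀ m, (1 - π X ^ (m + 1)) * π (boundedSeries 1 (m + 1)) = π (boundedSeries 1 m) := by
    intro m
    rw [← one_sub_mul_boundedSeries 1 m]
    simp only [map_mul, map_sub, map_pow, map_one, one_mul]
  have hB : ∀ m, (1 + π X ^ (m + 1)) * π (boundedSeries (-1) (m + 1)) =
      π (boundedSeries (-1) m) := by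
    intro m
    rw [← one_sub_mul_boundedSeries (-1) m]
    simp only [map_mul, map_add, map_pow, map_one, map_neg, neg_mul, one_mul, sub_neg_eq_add]
  have h1 := one_sub_mul_sum_sum_eq_diagonal (π X) (-1) L hq (fun m => π (boundedSeries 1 m))
    (fun m => π (boundedSeries (-1) m)) hA
    (by simpa only [neg_mul, one_mul, sub_neg_eq_add] using hB)
  have h2 := sum_signed_durfee_eq_theta (π X) L hq (fun m => π (boundedSeries 1 m))
    (fun m => π (boundedSeries (-1) m)) (hA0 1) (hA0 (-1)) hA hB
  rw [hP] at h2
  simp only [pow_mul, neg_one_sq, one_pow, one_mul] at h1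
  rw [h2] at h1
  simp only [map_mul, map_sub, map_sum, map_pow, map_one, map_neg]
  exact h1

theorem mk_X_pow_eq_zero (L : ℕ) :
    Ideal.Quotient.mk (Ideal.span {(X : ℤ⟦X⟧) ^ L}) X ^ L = 0 := by
  rw [← map_pow, Ideal.Quotient.eq_zero_iff_mem]
  exact Ideal.mem_span_singleton_self _

theorem coeff_mul_neg_one_pow (n e d : ℕ) (f : ℤ⟦X⟧) :
    coeff n (f * ((-1) ^ e * X ^ d)) = (-1) ^ e * coeff n (X ^ d * f) := by
  have h : (-1 : ℤ⟦X⟧) ^ e = C ((-1) ^ e) := by rw [map_pow, map_neg, map_one]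
  rw [h, mul_left_comm, coeff_C_mul, mul_comm f]

theorem coeff_partSeries_one_eq {n L : ℕ} (hn : 2 ≤ n) (hL : n < L) :
    coeff n (partSeries 1 fun s => Multiset.card (s.filter (s.count 1 < ·)) ≤ s.count 1) =
      ∑ k ∈ range L, (-1) ^ k *
        coeff n (partSeries 1 fun s => ∀ i, 1 ≤ i → i ≤ k → i ∈ s) := by
  rw [coeff_partSeries_eq_double_sum 1 hn hL, coeff_eq_of_mk_eq hL
    (map_double_sum_one_eq _ L (mk_X_pow_eq_zero L) (mk_boundedSeries_eq 1 L)), mul_sum, map_sum]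
  refine sum_congr rfl fun k _ => ?_
  rw [partSeries_contains, coeff_mul_neg_one_pow]

theorem coeff_partSeries_neg_one_eq {n L : ℕ} (hn : 2 ≤ n) (hL : n < L) :
    coeff n (partSeries (-1) fun s => Multiset.card (s.filter (s.count 1 < ·)) ≤ s.count 1) =
      ∑ k ∈ range L, (-1) ^ (∑ i ∈ range k, (i + 1)) *
        coeff n (partSeries 1 fun s => ∀ i, 1 ≤ i → i ≤ k → i ∈ s) := by
  rw [coeff_partSeries_eq_double_sum (-1) hn hL, coeff_eq_of_mk_eq hL
    (map_double_sum_neg_one_eq _ L (mk_X_pow_eq_zero L) (mk_boundedSeries_eq 1 L)),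
    mul_sum, map_sum]
  refine sum_congr rfl fun k _ => ?_
  rw [partSeries_contains, neg_pow X, coeff_mul_neg_one_pow]

theorem crank_le_zero_iff {n : ℕ} (hn : 0 < n) (P : Nat.Partition n) :
    crank P ≤ 0 ↔
      Multiset.card (P.parts.filter (P.parts.count 1 < ·)) ≤ P.parts.count 1 := by
  unfold crank partMu partOmega
  split_ifs with h
  · rw [h, Multiset.filter_eq_self.mpr fun i hi => P.parts_pos hi]
    have hne : P.parts ≠ 0 := by
      intro h0
      have := P.parts_sum
      simp [h0] at this
      lia
    obtain ⟨a, ha⟩ := Multiset.exists_mem_of_ne_zero hne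
    have h1 := Multiset.le_sup ha
    have h2 := P.parts_pos ha
    have h3 := Multiset.card_pos.mpr hne
    constructor <;> intro h4 <;> lia
  · lia

theorem lt_partMex_iff {n : ℕ} (P : Nat.Partition n) (k : ℕ) :
    k < partMex P ↔ ∀ i, 1 ≤ i → i ≤ k → i ∈ P.parts := by
  have hne : {k : ℕ | 0 < k ∧ k ∉ P.parts}.Nonempty := by
    refine ⟨n + 1, by lia, fun h => ?_⟩
    have := (Multiset.le_sum_of_mem h).trans_eq P.parts_sum
    lia
  constructor
  · intro hk i h1 h2
    by_contra hi
    have : partMex P ≤ i := Nat.sInf_le ⟨h1, hi⟩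
    lia
  · intro h
    by_contra! hk
    have := Nat.sInf_mem hne
    exact this.2 (h _ this.1 hk)

theorem partMex_le {n : ℕ} (P : Nat.Partition n) : partMex P ≤ n + 1 := by
  refine Nat.sInf_le ⟨by lia, fun h => ?_⟩
  have := (Multiset.le_sum_of_mem h).trans_eq P.parts_sum
  lia

theorem sum_mul_coeff_contains (n : ℕ) (c : ℕ → ℤ) :
    ∑ k ∈ range (n + 1), c k * coeff n (partSeries 1 fun s => ∀ i, 1 ≤ i → i ≤ k → i ∈ s) =
      ∑ P : Nat.Partition n, ∑ k ∈ range (partMex P), c k := by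
  simp only [coeff_partSeries, mul_sum]
  rw [sum_comm]
  refine sum_congr rfl fun P _ => ?_
  simp only [← lt_partMex_iff, one_pow, mul_ite, mul_one, mul_zero]
  rw [← sum_filter]
  refine sum_congr ?_ fun _ _ => rfl
  ext k
  have := partMex_le P
  simp only [mem_filter, mem_range]
  lia

theorem sum_neg_one_pow_eq_mod_four (M : ℕ) :
    ∑ k ∈ range M, (-1 : ℤ) ^ k =
      (if M % 4 = 1 then 1 else 0) + (if M % 4 = 3 then 1 else 0) := by
  induction M with
  | zero => simp
  | succ M ih =>
    rw [sum_range_succ, ih, neg_one_pow_eq_ite]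
    simp only [Nat.even_iff]
    split_ifs <;> lia

theorem sum_neg_one_pow_triangular (M : ℕ) :
    ∑ k ∈ range M, (-1 : ℤ) ^ (∑ i ∈ range k, (i + 1)) =
      (if M % 4 = 1 then 1 else 0) - (if M % 4 = 3 then 1 else 0) := by
  have h : ∀ k, (-1 : ℤ) ^ (∑ i ∈ range k, (i + 1)) =
      if k % 4 = 0 ∨ k % 4 = 3 then 1 else -1 := by
    intro k
    induction k with
    | zero => simp
    | succ k ih =>
      rw [sum_range_succ, pow_add, ih, neg_one_pow_eq_ite]
      simp only [Nat.even_iff]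
      split_ifs <;> lia
  induction M with
  | zero => simp
  | succ M ih =>
    rw [sum_range_succ, ih, h]
    split_ifs <;> lia

theorem natCard_partition_eq_sum {n : ℕ} (p : Nat.Partition n → Prop) :
    (Nat.card {P : Nat.Partition n // p P} : ℤ) =
      ∑ P : Nat.Partition n, if p P then 1 else 0 := by
  rw [Nat.card_eq_fintype_card, Fintype.card_subtype, card_filter]
  push_cast
  rfl

theorem natCard_crank_add {n : ℕ} (hn : 0 < n) :
    (Nat.card {P : Nat.Partition n // crank P ≤ 0 ∧ Even (Multiset.card P.parts)} : ℤ) +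
        Nat.card {P : Nat.Partition n // crank P ≤ 0 ∧ Odd (Multiset.card P.parts)} =
      coeff n (partSeries 1 fun s =>
        Multiset.card (s.filter (s.count 1 < ·)) ≤ s.count 1) := by
  rw [natCard_partition_eq_sum, natCard_partition_eq_sum, ← sum_add_distrib, coeff_partSeries]
  refine sum_congr rfl fun P _ => ?_
  rw [crank_le_zero_iff hn, ← Nat.not_even_iff_odd, one_pow]
  split_ifs <;> simp_all

theorem natCard_crank_sub {n : ℕ} (hn : 0 < n) :
    (Nat.card {P : Nat.Partition n // crank P ≤ 0 ∧ Even (Multiset.card P.parts)} : ℤ) -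
        Nat.card {P : Nat.Partition n // crank P ≤ 0 ∧ Odd (Multiset.card P.parts)} =
      coeff n (partSeries (-1) fun s =>
        Multiset.card (s.filter (s.count 1 < ·)) ≤ s.count 1) := by
  rw [natCard_partition_eq_sum, natCard_partition_eq_sum, ← sum_sub_distrib, coeff_partSeries]
  refine sum_congr rfl fun P _ => ?_
  rw [crank_le_zero_iff hn, ← Nat.not_even_iff_odd, neg_one_pow_eq_ite]
  split_ifs <;> simp_all

end CrankMex

/-- For `n ≥ 2`, the number of partitions of `n` with nonpositive crank and an even number
of parts equals `m_{1,4}(n)`, and the number of those with an odd number of parts equals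
`m_{3,4}(n)`. -/
theorem stmt_16 (n : ℕ) (hn : 2 ≤ n) :
    Nat.card {P : Nat.Partition n // crank P ≤ 0 ∧ Even (Multiset.card P.parts)} =
      Nat.card {P : Nat.Partition n // partMex P % 4 = 1} ∧
    Nat.card {P : Nat.Partition n // crank P ≤ 0 ∧ Odd (Multiset.card P.parts)} =
      Nat.card {P : Nat.Partition n // partMex P % 4 = 3} := by
  have h1 := natCard_crank_add (show 0 < n by lia)
  have h2 := natCard_crank_sub (show 0 < n by lia)
  rw [coeff_partSeries_one_eq hn (Nat.lt_succ_self n), sum_mul_coeff_contains] at h1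
  rw [coeff_partSeries_neg_one_eq hn (Nat.lt_succ_self n), sum_mul_coeff_contains] at h2
  simp only [sum_neg_one_pow_eq_mod_four, Finset.sum_add_distrib] at h1
  simp only [sum_neg_one_pow_triangular, Finset.sum_sub_distrib] at h2
  have h3 := natCard_partition_eq_sum fun P : Nat.Partition n => partMex P % 4 = 1
  have h4 := natCard_partition_eq_sum fun P : Nat.Partition n => partMex P % 4 = 3
  have e1 : ∑ P : Nat.Partition n, (if partMex P % 4 = 1 then 1 else 0 : ℤ) =
      Nat.card {P : Nat.Partition n // partMex P % 4 = 1} := by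
    rw [h3]
    refine Finset.sum_congr rfl fun P _ => ?_
    congr
  have e2 : ∑ P : Nat.Partition n, (if partMex P % 4 = 3 then 1 else 0 : ℤ) =
      Nat.card {P : Nat.Partition n // partMex P % 4 = 3} := by
    rw [h4]
    refine Finset.sum_congr rfl fun P _ => ?_
    congr
  rw [e1, e2] at h1 h2
  constructor <;> lia
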